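/- arXiv:math/0204238 — 4 statements merged into one kernel-verified Lean document; each statement's English description precedes it below -/
import Mathlib

section
/- Let K be a number field admitting a real embedding, with ring of integers R_K, and let F and Q be symmetric nondegenerate (n+1)×(n+1) matrices with entries in K which are equivalent over K via P ∈ GL(n+1,K), i.e. Pᵀ F P = Q. Then the conjugate P⁻¹ O(F;R_K) P is a subgroup of O(Q;K) which is commensurable with O(Q;R_K): the intersection P⁻¹ O(F;R_K) P ∩ O(Q;R_K) has finite index both in P⁻¹ O(F;R_K) P and in O(Q;R_K). -/
open Matrix

noncomputable section

/-- The orthogonal group of the (bilinear form attached to the) matrix `F`,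
as a subgroup of `GL (Fin m) R`: all `X` with `Xᵀ * F * X = F`. -/
def orthogonalSubgroup {m : ℕ} {R : Type*} [CommRing R] (F : Matrix (Fin m) (Fin m) R) :
    Subgroup (GL (Fin m) R) where
  carrier := {X | ((X : Matrix (Fin m) (Fin m) R))ᵀ * F * (X : Matrix (Fin m) (Fin m) R) = F}
  one_mem' := by simp
  mul_mem' := by
    intro a b ha hb
    simp only [Set.mem_setOf_eq] at *
    calc ((a * b : GL (Fin m) R) : Matrix (Fin m) (Fin m) R)ᵀ * F *
          ((a * b : GL (Fin m) R) : Matrix (Fin m) (Fin m) R)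
        = (b : Matrix (Fin m) (Fin m) R)ᵀ *
            ((a : Matrix (Fin m) (Fin m) R)ᵀ * F * (a : Matrix (Fin m) (Fin m) R)) *
            (b : Matrix (Fin m) (Fin m) R) := by
          simp [Units.val_mul, Matrix.transpose_mul, Matrix.mul_assoc]
      _ = F := by rw [ha, hb]
  inv_mem' := by
    intro X hX
    simp only [Set.mem_setOf_eq] at *
    have hXi : (X : Matrix (Fin m) (Fin m) R) * ((X⁻¹ : GL (Fin m) R) : Matrix (Fin m) (Fin m) R)
        = 1 := by
      rw [← Units.val_mul, mul_inv_cancel, Units.val_one]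
    calc ((X⁻¹ : GL (Fin m) R) : Matrix (Fin m) (Fin m) R)ᵀ * F *
          ((X⁻¹ : GL (Fin m) R) : Matrix (Fin m) (Fin m) R)
        = ((X⁻¹ : GL (Fin m) R) : Matrix (Fin m) (Fin m) R)ᵀ *
            ((X : Matrix (Fin m) (Fin m) R)ᵀ * F * (X : Matrix (Fin m) (Fin m) R)) *
            ((X⁻¹ : GL (Fin m) R) : Matrix (Fin m) (Fin m) R) := by rw [hX]
      _ = ((X : Matrix (Fin m) (Fin m) R) * ((X⁻¹ : GL (Fin m) R) : Matrix (Fin m) (Fin m) R))ᵀ *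
            F *
            ((X : Matrix (Fin m) (Fin m) R) * ((X⁻¹ : GL (Fin m) R) : Matrix (Fin m) (Fin m) R)) := by
          simp only [Matrix.transpose_mul, Matrix.mul_assoc]
      _ = F := by rw [hXi]; simp

/-- The subgroup of `GL (Fin m) K` consisting of the matrices which, together with their
inverses, have all entries in the subring `S` — i.e. the group `GL (Fin m) S` viewed inside
`GL (Fin m) K`. -/
def entriesInSubgroup {m : ℕ} {K : Type*} [CommRing K] (S : Subring K) :
    Subgroup (GL (Fin m) K) where
  carrier := {X | (∀ i j, (X : Matrix (Fin m) (Fin m) K) i j ∈ S) ∧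
    ∀ i j, ((X⁻¹ : GL (Fin m) K) : Matrix (Fin m) (Fin m) K) i j ∈ S}
  one_mem' := by
    constructor <;>
      · intro i j
        simp only [inv_one, Units.val_one, Matrix.one_apply]
        split <;> [exact one_mem S; exact zero_mem S]
  mul_mem' := by
    have hmul : ∀ A B : Matrix (Fin m) (Fin m) K, (∀ i j, A i j ∈ S) → (∀ i j, B i j ∈ S) →
        ∀ i j, (A * B) i j ∈ S := by
      intro A B hA hB i j
      rw [Matrix.mul_apply]
      exact Subring.sum_mem S fun k _ => S.mul_mem (hA i k) (hB k j)
    rintro a b ⟨ha1, ha2⟩ ⟨hb1, hb2⟩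
    constructor
    · intro i j
      rw [Units.val_mul]
      exact hmul _ _ ha1 hb1 i j
    · intro i j
      rw [_root_.mul_inv_rev, Units.val_mul]
      exact hmul _ _ hb2 ha2 i j
  inv_mem' := by
    rintro X ⟨h1, h2⟩
    refine ⟨h2, ?_⟩
    rw [inv_inv]
    exact h1

/-- The group `O(F; R_K)` of `R_K`-points of the orthogonal group of `F`, where `R_K` is the
ring of integers (= integral closure of `ℤ`) of the number field `K`. -/
def integralPointsOrthogonal {m : ℕ} {K : Type*} [Field K] (F : Matrix (Fin m) (Fin m) K) :
    Subgroup (GL (Fin m) K) :=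
  orthogonalSubgroup F ⊓ entriesInSubgroup (integralClosure ℤ K).toSubring

open scoped NumberField

/-- The ring of integers of `K` is the integral closure of `ℤ`, so `GL(m, R_K)` inside `GL(m, K)`
is the range of the map induced by `algebraMap`. -/
theorem entriesInSubgroup_eq_range {m : ℕ} (K : Type*) [Field K] :
    entriesInSubgroup (m := m) (integralClosure ℤ K).toSubring =
      (GeneralLinearGroup.map (n := Fin m) (algebraMap (𝓞 K) K)).range := by
  ext X
  constructor
  · rintro ⟨h1, h2⟩
    have hinj : Function.Injective (algebraMap (𝓞 K) K) := Subtype.val_injective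
    let A : Matrix (Fin m) (Fin m) (𝓞 K) := fun i j => ⟨X.1 i j, h1 i j⟩
    let B : Matrix (Fin m) (Fin m) (𝓞 K) := fun i j => ⟨(X⁻¹).1 i j, h2 i j⟩
    have hA : A.map (algebraMap (𝓞 K) K) = X.1 := rfl
    have hB : B.map (algebraMap (𝓞 K) K) = (X⁻¹).1 := rfl
    have hAB : A * B = 1 := by
      apply Matrix.map_injective hinj
      beta_reduce
      rw [Matrix.map_mul, hA, hB, X.mul_inv]
      simp
    have hBA : B * A = 1 := by
      apply Matrix.map_injective hinj
      beta_reduce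
      rw [Matrix.map_mul, hA, hB, X.inv_mul]
      simp
    exact ⟨⟨A, B, hAB, hBA⟩, Units.ext hA⟩
  · rintro ⟨Y, rfl⟩
    refine ⟨fun i j => (Y.1 i j).2, fun i j => ?_⟩
    rw [← map_inv]
    exact ((Y⁻¹).1 i j).2

/-- A common denominator for a square matrix over a number field. -/
theorem exists_smul_eq_map_ringOfIntegers {m : ℕ} (K : Type*) [Field K] [NumberField K]
    (M : Matrix (Fin m) (Fin m) K) :
    ∃ d : 𝓞 K, d ≠ 0 ∧ ∃ N : Matrix (Fin m) (Fin m) (𝓞 K),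
      N.map (algebraMap (𝓞 K) K) = algebraMap (𝓞 K) K d • M := by
  obtain ⟨b, hb⟩ := IsLocalization.exist_integer_multiples_of_finite
    (nonZeroDivisors (𝓞 K)) (fun p : Fin m × Fin m => M p.1 p.2)
  choose N hN using hb
  refine ⟨b, nonZeroDivisors.ne_zero b.2, fun i j => N (i, j), ?_⟩
  ext i j
  exact (hN (i, j)).trans (Algebra.smul_def _ _)

/-- An element of the principal congruence subgroup of level `a * b` stays integral after
conjugation by `g`, when `a` and `b` are denominators of `g` and `g⁻¹`. -/
theorem conj_map_entry_mem {m : ℕ} {K : Type*} [Field K] {g : GL (Fin m) K} {a b : 𝓞 K}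
    {A B : Matrix (Fin m) (Fin m) (𝓞 K)}
    (hA : A.map (algebraMap (𝓞 K) K) = algebraMap (𝓞 K) K a • g.1)
    (hB : B.map (algebraMap (𝓞 K) K) = algebraMap (𝓞 K) K b • (g⁻¹).1)
    {Y : GL (Fin m) (𝓞 K)}
    (hY : GeneralLinearGroup.map (Ideal.Quotient.mk (Ideal.span {a * b})) Y = 1) (i j : Fin m) :
    (g * GeneralLinearGroup.map (algebraMap (𝓞 K) K) Y * g⁻¹).1 i j ∈
      (integralClosure ℤ K).toSubring := by
  have hdvd : ∀ i j, ∃ z, Y.1 i j - (1 : Matrix (Fin m) (Fin m) (𝓞 K)) i j = a * b * z := by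
    intro i j
    rw [← dvd_def, ← Ideal.mem_span_singleton, ← Ideal.Quotient.eq]
    have h := congrArg (fun U => U.1 i j) hY
    simpa [Matrix.one_apply, apply_ite] using h
  choose Z hZ using hdvd
  have hYZ : Y.1 = 1 + (a * b) • Matrix.of Z := by
    ext i j : 2
    have h := hZ i j
    simp only [Matrix.add_apply, Matrix.smul_apply, Matrix.of_apply, smul_eq_mul]
    rw [← h, add_sub_cancel]
  have hmap : (GeneralLinearGroup.map (algebraMap (𝓞 K) K) Y).1 =
      1 + (algebraMap (𝓞 K) K a * algebraMap (𝓞 K) K b) •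
        (Matrix.of Z).map (algebraMap (𝓞 K) K) := by
    change Y.1.map (algebraMap (𝓞 K) K) = _
    rw [hYZ]
    ext i j
    simp [Matrix.one_apply, apply_ite]
  have key : (g * GeneralLinearGroup.map (algebraMap (𝓞 K) K) Y * g⁻¹).1 =
      (1 + A * Matrix.of Z * B).map (algebraMap (𝓞 K) K) := by
    rw [Matrix.map_add _ (map_add _), Matrix.map_mul, Matrix.map_mul, hA, hB, Units.val_mul,
      Units.val_mul, hmap, mul_add, add_mul, mul_one, g.mul_inv, Matrix.map_one _ (map_zero _)
      (map_one _)]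
    simp only [Matrix.smul_mul, Matrix.mul_smul, smul_smul, mul_comm]
  rw [key]
  exact ((1 + A * Matrix.of Z * B) i j).2

/-- `GL(m, R_K)` is commensurated by `GL(m, K)`. -/
theorem relIndex_comap_conj_entriesInSubgroup_ne_zero {m : ℕ} (K : Type*) [Field K]
    [NumberField K] (g : GL (Fin m) K) :
    ((entriesInSubgroup (m := m) (integralClosure ℤ K).toSubring).comap
      (MulAut.conj g).toMonoidHom).relIndex
        (entriesInSubgroup (m := m) (integralClosure ℤ K).toSubring) ≠ 0 := by
  obtain ⟨a, ha, A, hA⟩ := exists_smul_eq_map_ringOfIntegers K g.1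
  obtain ⟨b, hb, B, hB⟩ := exists_smul_eq_map_ringOfIntegers K (g⁻¹).1
  let I : Ideal (𝓞 K) := Ideal.span {a * b}
  have hI : I ≠ ⊥ := by simp [I, ha, hb]
  have : Finite (𝓞 K ⧸ I) := Ring.HasFiniteQuotients.finiteQuotient hI
  let ρ : GL (Fin m) (𝓞 K) →* GL (Fin m) (𝓞 K ⧸ I) :=
    GeneralLinearGroup.map (Ideal.Quotient.mk I)
  have : Finite (GL (Fin m) (𝓞 K ⧸ I)) :=
    Finite.of_injective _ (Units.val_injective (α := Matrix (Fin m) (Fin m) (𝓞 K ⧸ I)))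
  conv in Subgroup.relIndex _ _ => rw [entriesInSubgroup_eq_range K]
  rw [MonoidHom.range_eq_map (GeneralLinearGroup.map (n := Fin m) (algebraMap (𝓞 K) K)),
    ← Subgroup.relIndex_comap, Subgroup.relIndex_top_right, ← MonoidHom.range_eq_map,
    ← entriesInSubgroup_eq_range]
  have hle : ρ.ker ≤ ((entriesInSubgroup (m := m) (integralClosure ℤ K).toSubring).comap
      (MulAut.conj g).toMonoidHom).comap (GeneralLinearGroup.map (algebraMap (𝓞 K) K)) := by
    intro Y hY
    refine ⟨conj_map_entry_mem hA hB hY, ?_⟩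
    have h := conj_map_entry_mem hA hB (inv_mem hY)
    simpa [mul_assoc] using h
  exact (Subgroup.finiteIndex_of_le hle).index_ne_zero

/-- Conjugation by an equivalence of forms carries one orthogonal group onto the other. -/
theorem map_conj_inv_orthogonalSubgroup {m : ℕ} {R : Type*} [CommRing R]
    {F Q : Matrix (Fin m) (Fin m) R} (P : GL (Fin m) R) (hPFQ : P.1ᵀ * F * P.1 = Q) :
    (orthogonalSubgroup F).map (MulAut.conj P⁻¹).toMonoidHom = orthogonalSubgroup Q := by
  have hle : ∀ {F Q : Matrix (Fin m) (Fin m) R} (P : GL (Fin m) R), P.1ᵀ * F * P.1 = Q →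
      ∀ X ∈ orthogonalSubgroup F, P⁻¹ * X * P ∈ orthogonalSubgroup Q := by
    intro F Q P h X hX
    change X.1ᵀ * F * X.1 = F at hX
    change (P⁻¹ * X * P).1ᵀ * Q * (P⁻¹ * X * P).1 = Q
    have hP : P.1 * (P⁻¹ * X * P).1 = X.1 * P.1 := by
      rw [← Units.val_mul, ← Units.val_mul]
      congr 1
      group
    calc (P⁻¹ * X * P).1ᵀ * Q * (P⁻¹ * X * P).1
        = (P.1 * (P⁻¹ * X * P).1)ᵀ * F * (P.1 * (P⁻¹ * X * P).1) := by
          simp only [← h, Matrix.transpose_mul, Matrix.mul_assoc]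
      _ = P.1ᵀ * (X.1ᵀ * F * X.1) * P.1 := by
          rw [hP]; simp only [Matrix.transpose_mul, Matrix.mul_assoc]
      _ = Q := by rw [hX, h]
  have hinv : (P⁻¹).1ᵀ * Q * (P⁻¹).1 = F := by
    calc (P⁻¹).1ᵀ * Q * (P⁻¹).1
        = (P.1 * (P⁻¹).1)ᵀ * F * (P.1 * (P⁻¹).1) := by
          simp only [← hPFQ, Matrix.transpose_mul, Matrix.mul_assoc]
      _ = F := by rw [P.mul_inv]; simp
  apply le_antisymm
  · rintro _ ⟨X, hX, rfl⟩
    simpa using hle P hPFQ X hX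
  · intro X hX
    exact ⟨_, hle P⁻¹ hinv X hX, by simp [mul_assoc]⟩

/-- **Lemma 2.1 (second part)** (Long–Reid). Let `K` be a number field with a real embedding
`σ`, and let `F`, `Q` be symmetric nondegenerate matrices over `K`, equivalent over `K` via
`P` (so `Pᵀ F P = Q`).  Then `P⁻¹ O(F; R_K) P` is a subgroup of `O(Q; K)` which is
commensurable with `O(Q; R_K)`: the intersection has finite index in both. -/
theorem conjugate_integral_orthogonal_commensurable
    (K : Type*) [Field K] [NumberField K] (σ : K →+* ℝ) (n : ℕ)
    (F Q : Matrix (Fin (n + 1)) (Fin (n + 1)) K)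
    (hFsymm : Fᵀ = F) (hQsymm : Qᵀ = Q) (hFdet : F.det ≠ 0) (hQdet : Q.det ≠ 0)
    (P : GL (Fin (n + 1)) K)
    (hPFQ : (P : Matrix (Fin (n + 1)) (Fin (n + 1)) K)ᵀ * F *
        (P : Matrix (Fin (n + 1)) (Fin (n + 1)) K) = Q) :
    Subgroup.map (MulAut.conj P⁻¹).toMonoidHom (integralPointsOrthogonal F) ≤
        orthogonalSubgroup Q ∧
      ((Subgroup.map (MulAut.conj P⁻¹).toMonoidHom (integralPointsOrthogonal F) ⊓
            integralPointsOrthogonal Q).subgroupOf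
          (Subgroup.map (MulAut.conj P⁻¹).toMonoidHom (integralPointsOrthogonal F))).FiniteIndex ∧
      ((Subgroup.map (MulAut.conj P⁻¹).toMonoidHom (integralPointsOrthogonal F) ⊓
            integralPointsOrthogonal Q).subgroupOf (integralPointsOrthogonal Q)).FiniteIndex := by
  set E := entriesInSubgroup (m := n + 1) (integralClosure ℤ K).toSubring
  set M := (integralPointsOrthogonal F).map (MulAut.conj P⁻¹).toMonoidHom with hM
  have hMeq : M = orthogonalSubgroup Q ⊓ E.map (MulAut.conj P⁻¹).toMonoidHom := by
    rw [hM, integralPointsOrthogonal, Subgroup.map_inf _ _ _ (MulAut.conj P⁻¹).injective,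
      map_conj_inv_orthogonalSubgroup P hPFQ]
  have hcomap : E.map (MulAut.conj P⁻¹).toMonoidHom = E.comap (MulAut.conj P).toMonoidHom := by
    rw [map_inv]
    exact (Subgroup.comap_equiv_eq_map_symm' (MulAut.conj P) E).symm
  refine ⟨hMeq ▸ inf_le_left, ⟨?_⟩, ⟨?_⟩⟩
  · change (M ⊓ integralPointsOrthogonal Q).relIndex M ≠ 0
    have h := relIndex_comap_conj_entriesInSubgroup_ne_zero (m := n + 1) K P⁻¹
    rw [Subgroup.relIndex_comap] at h
    have hME : E.relIndex M ≠ 0 := fun h0 =>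
      h (Subgroup.relIndex_eq_zero_of_le_right (hMeq ▸ inf_le_right) h0)
    rw [← Subgroup.inf_relIndex_left] at hME
    have hle : M ⊓ E ≤ M ⊓ integralPointsOrthogonal Q :=
      le_inf inf_le_left (le_inf (inf_le_left.trans (hMeq ▸ inf_le_left)) inf_le_right)
    exact fun h0 => hME (Subgroup.relIndex_eq_zero_of_le_left hle h0)
  · change (M ⊓ integralPointsOrthogonal Q).relIndex (integralPointsOrthogonal Q) ≠ 0
    have h := relIndex_comap_conj_entriesInSubgroup_ne_zero (m := n + 1) K P
    rw [← hcomap] at h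
    have hQ : (E.map (MulAut.conj P⁻¹).toMonoidHom).relIndex (integralPointsOrthogonal Q) ≠ 0 :=
      fun h0 => h (Subgroup.relIndex_eq_zero_of_le_right inf_le_right h0)
    rw [← Subgroup.inf_relIndex_right] at hQ
    have hle : E.map (MulAut.conj P⁻¹).toMonoidHom ⊓ integralPointsOrthogonal Q ≤
        M ⊓ integralPointsOrthogonal Q := by
      rw [hMeq]
      exact le_inf (le_inf (inf_le_right.trans inf_le_left) inf_le_left) inf_le_right
    exact fun h0 => hQ (Subgroup.relIndex_eq_zero_of_le_left hle h0)
end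
end

section
/- Let n ≥ 1 and let Γ be an n-dimensional crystallographic group, i.e. a discrete cocompact subgroup of the isometry group of Euclidean n-space. Then the set T of pure translations contained in Γ is a normal subgroup of Γ of finite index, and T is a free abelian group of rank n (isomorphic to ℤⁿ). -/
open Matrix

noncomputable section

/-- The topology on the isometry group of Euclidean `n`-space, induced from
the topology of pointwise convergence on maps. -/
instance euclideanIsometryGroupTopology (n : ℕ) :
    TopologicalSpace (EuclideanSpace ℝ (Fin n) ≃ᵢ EuclideanSpace ℝ (Fin n)) :=
  TopologicalSpace.induced
    (fun f => (f : EuclideanSpace ℝ (Fin n) → EuclideanSpace ℝ (Fin n))) inferInstance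

/-- The natural action of the isometry group on Euclidean `n`-space. -/
instance euclideanIsometryGroupAction (n : ℕ) :
    MulAction (EuclideanSpace ℝ (Fin n) ≃ᵢ EuclideanSpace ℝ (Fin n))
      (EuclideanSpace ℝ (Fin n)) where
  smul f x := f x
  one_smul _ := rfl
  mul_smul _ _ _ := rfl

/-- A subgroup of the isometry group of Euclidean `n`-space is crystallographic if it is
discrete and acts cocompactly (the orbit-space quotient is compact). -/
def IsCrystallographic {n : ℕ}
    (Γ : Subgroup (EuclideanSpace ℝ (Fin n) ≃ᵢ EuclideanSpace ℝ (Fin n))) : Prop :=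
  DiscreteTopology Γ ∧
    CompactSpace (MulAction.orbitRel.Quotient Γ (EuclideanSpace ℝ (Fin n)))

/-- The subgroup of pure translations of Euclidean `n`-space: isometries of the form
`x ↦ x + t`. -/
def translationSubgroup (n : ℕ) :
    Subgroup (EuclideanSpace ℝ (Fin n) ≃ᵢ EuclideanSpace ℝ (Fin n)) where
  carrier := {f | ∃ t, ∀ x, f x = x + t}
  one_mem' := ⟨0, fun x => by simp⟩
  mul_mem' := by
    rintro f g ⟨t, ht⟩ ⟨s, hs⟩
    exact ⟨s + t, fun x => by
      show f (g x) = x + (s + t)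
      rw [hs, ht, add_assoc]⟩
  inv_mem' := by
    rintro f ⟨t, ht⟩
    refine ⟨-t, fun x => ?_⟩
    show f.symm x = x + -t
    rw [f.symm_apply_eq, ht]
    abel

end

/-- A family of points which is bounded and uniformly separated is finite. -/
theorem Set.Finite.of_isBounded_image_of_separated {ι X : Type*} [PseudoMetricSpace X]
    [ProperSpace X] {s : Set ι} {f : ι → X} (hb : Bornology.IsBounded (f '' s)) {ε : ℝ}
    (hε : 0 < ε) (h : ∀ i ∈ s, ∀ j ∈ s, dist (f i) (f j) < ε → i = j) : s.Finite := by
  by_contra hs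
  obtain ⟨u, hu⟩ : ∃ u : ℕ → s, Function.Injective u :=
    ⟨_, (Set.Infinite.natEmbedding s hs).injective⟩
  obtain ⟨a, -, φ, hφ, hlim⟩ := tendsto_subseq_of_bounded hb
    (x := fun k => f (u k)) (fun k => ⟨_, (u k).2, rfl⟩)
  obtain ⟨N, hN⟩ := Metric.cauchySeq_iff.mp hlim.cauchySeq ε hε
  have := h _ (u (φ N)).2 _ (u (φ (N + 1))).2 (hN N le_rfl (N + 1) (by omega))
  have := hφ.injective (hu (Subtype.ext this))
  omega

section IsometrySubgroup

variable {E : Type*} [NormedAddCommGroup E] {Γ : Subgroup (E ≃ᵢ E)}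

theorem exists_min_norm (hfin : ∀ R : ℝ, {g | g ∈ Γ ∧ ‖g 0‖ ≤ R}.Finite) {s : Set (E ≃ᵢ E)}
    (hs : s ⊆ Γ) (hne : s.Nonempty) : ∃ g ∈ s, ∀ h ∈ s, ‖g 0‖ ≤ ‖h 0‖ := by
  obtain ⟨g₀, hg₀⟩ := hne
  have hf : {g | g ∈ s ∧ ‖g 0‖ ≤ ‖g₀ 0‖}.Finite :=
    (hfin ‖g₀ 0‖).subset fun g hg => ⟨hs hg.1, hg.2⟩
  obtain ⟨g, hg, hmin⟩ := Set.exists_min_image _ (fun g : E ≃ᵢ E => ‖g 0‖) hf ⟨g₀, hg₀, le_rfl⟩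
  refine ⟨g, hg.1, fun h hh => ?_⟩
  rcases le_total ‖h 0‖ ‖g₀ 0‖ with h1 | h1
  · exact hmin h ⟨hh, h1⟩
  · exact hg.2.trans h1

/-- The lattice of translation vectors of a subgroup of the isometry group. -/
def translationLattice (Γ : Subgroup (E ≃ᵢ E)) : AddSubgroup E where
  carrier := {t | IsometryEquiv.addRight t ∈ Γ}
  zero_mem' := by
    have h : IsometryEquiv.addRight (0 : E) = 1 := by ext x; simp
    rw [Set.mem_ofPred_eq, h]; exact Γ.one_mem
  add_mem' {s t} hs ht := by
    have h : IsometryEquiv.addRight (s + t) =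
        IsometryEquiv.addRight t * IsometryEquiv.addRight s := by
      ext x
      simp [IsometryEquiv.mul_apply, add_assoc]
    rw [Set.mem_ofPred_eq, h]; exact Γ.mul_mem ht hs
  neg_mem' {t} ht := by
    have h : IsometryEquiv.addRight (-t) = (IsometryEquiv.addRight t)⁻¹ :=
      (IsometryEquiv.addRight_symm t).symm
    rw [Set.mem_ofPred_eq, h]; exact Γ.inv_mem ht

theorem mem_translationLattice {t : E} :
    t ∈ translationLattice Γ ↔ IsometryEquiv.addRight t ∈ Γ := Iff.rfl

end IsometrySubgroup

section Expansion

variable {E : Type*} [NormedAddCommGroup E] [InnerProductSpace ℝ E] [FiniteDimensional ℝ E]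

/-- For a normal operator `S` and a positive `c` that is not a singular value, the cone
`{x | c * ‖x‖ ≤ ‖S x‖}` is mapped by `S` into its own interior, uniformly. -/
theorem ContinuousLinearMap.exists_uniform_gain (S : E →L[ℝ] E)
    (hS : ∀ y, ‖S.adjoint y‖ = ‖S y‖) {c : ℝ} (hc : 0 < c)
    (hev : ∀ x, S.adjoint (S x) = c ^ 2 • x → x = 0) :
    ∃ η > 0, ∀ x, c * ‖x‖ ≤ ‖S x‖ → c * ‖S x‖ + η * ‖x‖ ≤ ‖S (S x)‖ := by
  have hK : IsCompact (Metric.sphere (0 : E) 1 ∩ {x | c ≤ ‖S x‖}) :=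
    (isCompact_sphere 0 1).inter_right (isClosed_le continuous_const (by fun_prop))
  have hpos : ∀ x ∈ Metric.sphere (0 : E) 1 ∩ {x | c ≤ ‖S x‖}, 0 < ‖S (S x)‖ - c * ‖S x‖ := by
    rintro x ⟨hx1, hx2⟩
    simp only [mem_sphere_iff_norm, sub_zero, Set.mem_ofPred_eq] at hx1 hx2
    have h1 : inner ℝ (S.adjoint (S x)) x = ‖S x‖ ^ 2 := by
      rw [ContinuousLinearMap.adjoint_inner_left, real_inner_self_eq_norm_sq]
    have h2 : ‖S x‖ ^ 2 ≤ ‖S (S x)‖ := by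
      have := real_inner_le_norm (S.adjoint (S x)) x
      rwa [h1, hx1, mul_one, hS] at this
    by_contra! hle
    have h3 : ‖S x‖ = c := by
      refine le_antisymm ?_ hx2
      have : ‖S x‖ * ‖S x‖ ≤ c * ‖S x‖ := by nlinarith
      exact le_of_mul_le_mul_right this (hc.trans_le hx2)
    have h4 : ‖S.adjoint (S x) - c ^ 2 • x‖ ^ 2 = 0 := by
      have h5 : ‖S (S x)‖ = c ^ 2 := by rw [h3] at h2 hle; nlinarith
      rw [norm_sub_sq_real, inner_smul_right, h1, hS, h5, norm_smul, hx1, h3, Real.norm_eq_abs,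
        abs_of_nonneg (sq_nonneg c)]
      ring
    have h6 : x = 0 := hev x (sub_eq_zero.mp (by simpa using h4))
    simp [h6] at hx1
  obtain ⟨η, hη, hle⟩ := hK.exists_forall_le' (f := fun x => ‖S (S x)‖ - c * ‖S x‖) (a := 0)
    (by fun_prop) hpos
  refine ⟨η, hη, fun x hx => ?_⟩
  rcases eq_or_ne x 0 with rfl | hx0
  · simp
  have hn : 0 < ‖x‖ := norm_pos_iff.mpr hx0
  have := hle (‖x‖⁻¹ • x) ⟨by simp [norm_smul, hn.ne'], by
    simp only [Set.mem_ofPred_eq, map_smul, norm_smul, norm_inv, norm_norm]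
    rwa [inv_mul_eq_div, le_div_iff₀ hn]⟩
  simp only [map_smul, norm_smul, norm_inv, norm_norm] at this
  have h := mul_le_mul_of_nonneg_left this hn.le
  field_simp at h
  linarith

/-- Below every positive bound there is a positive number that is not a singular value of `S`. -/
theorem ContinuousLinearMap.exists_pos_lt_not_singularValue (S : E →L[ℝ] E) {m : ℝ}
    (hm : 0 < m) :
    ∃ c, 0 < c ∧ c < m ∧ ∀ x, S.adjoint (S x) = c ^ 2 • x → x = 0 := by
  obtain ⟨t, ⟨ht0, htm⟩, ht⟩ := ((Set.Ioo_infinite (a := 0) (b := m ^ 2) (by positivity)).sdiff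
    (Module.End.finite_hasEigenvalue
      ((S.adjoint ∘L S : E →L[ℝ] E) : Module.End ℝ E))).nonempty
  refine ⟨√t, Real.sqrt_pos.mpr ht0, (Real.sqrt_lt' hm).mpr htm, fun x hx => ?_⟩
  rw [Real.sq_sqrt ht0.le] at hx
  by_contra hx0
  exact ht (Module.End.hasEigenvalue_of_hasEigenvector
    (Module.End.hasEigenvector_iff.mpr ⟨Module.End.mem_eigenspace_iff.mpr hx, hx0⟩))

end Expansion

section LinearPart

variable {E : Type*} [NormedAddCommGroup E] [InnerProductSpace ℝ E]

/-- The linear part of an isometry, as a monoid homomorphism to continuous linear maps. -/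
noncomputable def linearPart : (E ≃ᵢ E) →* (E →L[ℝ] E) where
  toFun g := g.toRealLinearIsometryEquiv.toLinearIsometry.toContinuousLinearMap
  map_one' := by ext x; simp
  map_mul' g h := by
    ext x
    have key := g.toRealLinearIsometryEquiv.map_sub (h x) (h 0)
    simp only [IsometryEquiv.toRealLinearIsometryEquiv_apply] at key
    simp [IsometryEquiv.mul_apply, key]

theorem linearPart_apply (g : E ≃ᵢ E) (x : E) : linearPart g x = g x - g 0 := by
  simp [linearPart]

theorem apply_eq_linearPart_add (g : E ≃ᵢ E) (x : E) : g x = linearPart g x + g 0 := by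
  simp [linearPart_apply]

@[simp]
theorem norm_linearPart_apply (g : E ≃ᵢ E) (x : E) : ‖linearPart g x‖ = ‖x‖ :=
  g.toRealLinearIsometryEquiv.norm_map x

theorem norm_linearPart_le (g : E ≃ᵢ E) : ‖linearPart g‖ ≤ 1 :=
  LinearIsometry.norm_toContinuousLinearMap_le _

theorem linearPart_mul_inv (g : E ≃ᵢ E) : linearPart g * linearPart g⁻¹ = 1 := by
  rw [← map_mul, mul_inv_cancel, map_one]

theorem linearPart_inv_mul (g : E ≃ᵢ E) : linearPart g⁻¹ * linearPart g = 1 := by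
  rw [← map_mul, inv_mul_cancel, map_one]

theorem norm_linearPart_mul_le (g : E ≃ᵢ E) (T : E →L[ℝ] E) : ‖linearPart g * T‖ ≤ ‖T‖ :=
  (norm_mul_le _ _).trans (mul_le_of_le_one_left (norm_nonneg _) (norm_linearPart_le g))

theorem norm_mul_linearPart_le (g : E ≃ᵢ E) (T : E →L[ℝ] E) : ‖T * linearPart g‖ ≤ ‖T‖ :=
  (norm_mul_le _ _).trans (mul_le_of_le_one_right (norm_nonneg _) (norm_linearPart_le g))

theorem ext_of_linearPart {g h : E ≃ᵢ E} (h1 : linearPart g = linearPart h) (h0 : g 0 = h 0) :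
    g = h := by
  ext x
  rw [apply_eq_linearPart_add, h1, h0, ← apply_eq_linearPart_add]

theorem addRight_apply_zero_eq_self {g : E ≃ᵢ E} (h : linearPart g = 1) :
    IsometryEquiv.addRight (g 0) = g := by
  ext x
  rw [apply_eq_linearPart_add g x, h]
  rfl

theorem inv_mul_apply_zero (g h : E ≃ᵢ E) : (g⁻¹ * h) 0 = linearPart g⁻¹ (h 0 - g 0) := by
  have : g⁻¹ (g 0) = 0 := by rw [← IsometryEquiv.mul_apply, inv_mul_cancel]; rfl
  rw [map_sub, linearPart_apply, linearPart_apply, this, IsometryEquiv.mul_apply]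
  abel

theorem mul_inv_apply_zero (g h : E ≃ᵢ E) : (g * h⁻¹) 0 = g 0 - linearPart (g * h⁻¹) (h 0) := by
  have : (g * h⁻¹) (h 0) = g 0 := by rw [← IsometryEquiv.mul_apply, inv_mul_cancel_right]
  rw [linearPart_apply, this]
  abel

theorem norm_linearPart_inv_mul_sub_one_le (g h : E ≃ᵢ E) :
    ‖linearPart (g⁻¹ * h) - 1‖ ≤ ‖linearPart h - linearPart g‖ := by
  rw [← linearPart_inv_mul g, map_mul, ← mul_sub]
  exact norm_linearPart_mul_le _ _

theorem norm_linearPart_mul_inv_sub_one_le (g h : E ≃ᵢ E) :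
    ‖linearPart (g * h⁻¹) - 1‖ ≤ ‖linearPart g - linearPart h‖ := by
  rw [← linearPart_mul_inv h, map_mul, ← sub_mul]
  exact norm_mul_linearPart_le _ _

theorem norm_linearPart_conj_sub_one_le (g h : E ≃ᵢ E) :
    ‖linearPart (g * h * g⁻¹) - 1‖ ≤ ‖linearPart h - 1‖ := by
  have : linearPart (g * h * g⁻¹) - 1 = linearPart g * ((linearPart h - 1) * linearPart g⁻¹) := by
    rw [← linearPart_mul_inv g, map_mul, map_mul]
    nth_rewrite 2 [linearPart_mul_inv g]
    rw [sub_mul, mul_sub, one_mul, mul_assoc]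
  rw [this]
  exact (norm_linearPart_mul_le _ _).trans (norm_mul_linearPart_le _ _)

theorem norm_linearPart_commutator_sub_one_le (g h : E ≃ᵢ E) :
    ‖linearPart (g * h * g⁻¹ * h⁻¹) - 1‖ ≤ 2 * ‖linearPart g - 1‖ * ‖linearPart h - 1‖ := by
  have e : g * h * g⁻¹ * h⁻¹ = g * h * (h * g)⁻¹ := by group
  rw [e]
  refine (norm_linearPart_mul_inv_sub_one_le _ _).trans ?_
  have : linearPart (g * h) - linearPart (h * g) =
      (linearPart g - 1) * (linearPart h - 1) - (linearPart h - 1) * (linearPart g - 1) := by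
    rw [map_mul, map_mul]; noncomm_ring
  rw [this]
  refine (norm_sub_le _ _).trans ?_
  have h1 := norm_mul_le (linearPart g - 1) (linearPart h - 1)
  have h2 := norm_mul_le (linearPart h - 1) (linearPart g - 1)
  linarith

theorem commutator_apply_zero (g h : E ≃ᵢ E) :
    (g * h * g⁻¹ * h⁻¹) 0 = (linearPart g - 1) (h 0) -
      ((linearPart (g * h * g⁻¹ * h⁻¹) - 1) (h 0) + (linearPart (g * h * g⁻¹) - 1) (g 0)) := by
  rw [mul_inv_apply_zero (g * h * g⁻¹) h, mul_inv_apply_zero (g * h) g, IsometryEquiv.mul_apply,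
    apply_eq_linearPart_add g (h 0)]
  simp only [_root_.sub_apply, one_apply_eq_self]
  abel

theorem norm_adjoint_linearPart_sub_one [CompleteSpace E] (g : E ≃ᵢ E) (y : E) :
    ‖(linearPart g - 1).adjoint y‖ = ‖(linearPart g - 1) y‖ := by
  have hinner (x y : E) : inner ℝ (linearPart g x) (linearPart g y) = inner ℝ x y :=
    g.toRealLinearIsometryEquiv.inner_map_map x y
  have hy (y : E) : linearPart g (linearPart g⁻¹ y) = y :=
    DFunLike.congr_fun (linearPart_mul_inv g) y
  have : (linearPart g - 1).adjoint = linearPart g⁻¹ - 1 := by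
    symm
    rw [ContinuousLinearMap.eq_adjoint_iff]
    intro x y
    simp only [_root_.sub_apply, one_apply_eq_self, inner_sub_left,
      inner_sub_right]
    rw [← hinner (linearPart g⁻¹ x) y, hy]
  rw [this, ← norm_linearPart_apply g, ← norm_neg]
  congr 1
  simp [hy]

end LinearPart

section Bieberbach

variable {E : Type*} [NormedAddCommGroup E] [InnerProductSpace ℝ E] [FiniteDimensional ℝ E]
  {Γ : Subgroup (E ≃ᵢ E)}

theorem exists_near_direction (hco : ∃ d : ℝ, ∀ x, ∃ g ∈ Γ, ‖g 0 - x‖ ≤ d) (u : E) {ε δ : ℝ}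
    (hε : 0 < ε) (hδ : 0 < δ) :
    ∃ g ∈ Γ, ∃ k : ℝ, 0 < k ∧ ‖linearPart g - 1‖ ≤ ε ∧ ‖g 0 - k • u‖ < δ * k := by
  obtain ⟨d, hd⟩ := hco
  choose γ hγ hγd using fun k : ℕ => hd ((k : ℝ) • u)
  obtain ⟨a, -, φ, hφ, hlim⟩ := tendsto_subseq_of_bounded
    (Metric.isBounded_closedBall (x := (0 : E →L[ℝ] E)) (r := 1))
    (x := fun k => linearPart (γ k)) (fun k => by simpa using norm_linearPart_le (γ k))
  obtain ⟨N, hN⟩ := Metric.cauchySeq_iff.mp hlim.cauchySeq ε hε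
  obtain ⟨j, hj⟩ := exists_nat_gt ((d + ‖γ (φ N) 0‖) / δ)
  have hjφ : ((max j (N + 1) : ℕ) : ℝ) ≤ φ (max j (N + 1)) := by exact_mod_cast hφ.le_apply
  set i := max j (N + 1)
  have hji : (j : ℝ) ≤ i := by exact_mod_cast le_max_left _ _
  have hi1 : (1 : ℝ) ≤ i := by
    exact_mod_cast (Nat.le_add_left 1 N).trans (le_max_right j (N + 1))
  refine ⟨γ (φ i) * (γ (φ N))⁻¹, Γ.mul_mem (hγ _) (Γ.inv_mem (hγ _)), φ i, by linarith, ?_, ?_⟩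
  · refine (norm_linearPart_mul_inv_sub_one_le _ _).trans ?_
    have := hN i ((Nat.le_succ N).trans (le_max_right _ _)) N le_rfl
    rw [dist_eq_norm] at this
    exact this.le
  · rw [mul_inv_apply_zero, sub_right_comm]
    refine (norm_sub_le _ _).trans_lt ?_
    rw [norm_linearPart_apply]
    rw [div_lt_iff₀ hδ] at hj
    have := hγd (φ i)
    nlinarith

theorem linearPart_eq_one_of_norm_le (hfin : ∀ R : ℝ, {g | g ∈ Γ ∧ ‖g 0‖ ≤ R}.Finite)
    (hco : ∃ d : ℝ, ∀ x, ∃ g ∈ Γ, ‖g 0 - x‖ ≤ d) {g : E ≃ᵢ E} (hg : g ∈ Γ)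
    (hg2 : ‖linearPart g - 1‖ ≤ 1 / 2) : linearPart g = 1 := by
  by_contra hne
  obtain ⟨α, ⟨hα, hα2, hα1⟩, hαmin⟩ := exists_min_norm hfin
    (s := {g | g ∈ Γ ∧ ‖linearPart g - 1‖ ≤ 1 / 2 ∧ linearPart g ≠ 1}) (fun _ h => h.1)
    ⟨g, hg, hg2, hne⟩
  set S := linearPart α - 1 with hS
  have hm : 0 < ‖S‖ := norm_pos_iff.mpr (sub_ne_zero.mpr hα1)
  obtain ⟨c, hc, hcm, hev⟩ := S.exists_pos_lt_not_singularValue hm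
  obtain ⟨η, hη, hgain⟩ := S.exists_uniform_gain (norm_adjoint_linearPart_sub_one α) hc hev
  obtain ⟨u, hu⟩ : ∃ u, c * ‖u‖ < ‖S u‖ := by
    by_contra! h
    exact hcm.not_ge (S.opNorm_le_bound hc.le h)
  obtain ⟨δ, hδ, hball⟩ := Metric.isOpen_iff.mp
    (isOpen_lt (f := fun x => c * ‖x‖) (g := fun x => ‖S x‖) (by fun_prop) (by fun_prop)) u hu
  -- `ε` bounds the rotation parts in the cone; the commutator error is at most `2 * ε * ‖b‖`.
  obtain ⟨ε, hε, hε8, hεc, hεη⟩ : ∃ ε : ℝ, 0 < ε ∧ ε ≤ 1 / 8 ∧ 2 * ε < c ∧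
      (‖S‖ + c) * (2 * ε) ≤ η := by
    refine ⟨min (1 / 8) (min (c / 4) (η / (2 * (‖S‖ + c)))), by positivity, min_le_left _ _, ?_, ?_⟩
    · have := (min_le_right (1 / 8) _).trans (min_le_left (c / 4) (η / (2 * (‖S‖ + c))))
      linarith
    · have := (min_le_right (1 / 8) _).trans (min_le_right (c / 4) (η / (2 * (‖S‖ + c))))
      rw [le_div_iff₀ (by positivity)] at this
      linarith
  obtain ⟨β, ⟨hβ, hβ0, hβε, hβc⟩, hβmin⟩ := exists_min_norm hfin
    (s := {g | g ∈ Γ ∧ g 0 ≠ 0 ∧ ‖linearPart g - 1‖ ≤ ε ∧ c * ‖g 0‖ ≤ ‖S (g 0)‖})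
    (fun _ h => h.1) (by
      obtain ⟨g, hg, k, hk, hgε, hgu⟩ := exists_near_direction hco u hε hδ
      have hmem : k⁻¹ • g 0 ∈ Metric.ball u δ := by
        rw [mem_ball_iff_norm]
        have : k⁻¹ • g 0 - u = k⁻¹ • (g 0 - k • u) := by
          rw [smul_sub, inv_smul_smul₀ hk.ne']
        rw [this, norm_smul, norm_inv, Real.norm_eq_abs, abs_of_pos hk, inv_mul_lt_iff₀ hk]
        linarith
      have h := hball hmem
      simp only [Set.mem_ofPred_eq, map_smul, norm_smul] at h
      have hlt : c * ‖g 0‖ < ‖S (g 0)‖ := by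
        refine lt_of_mul_lt_mul_left ?_ (norm_nonneg k⁻¹)
        linarith
      refine ⟨g, hg, fun h0 => ?_, hgε, hlt.le⟩
      simp [h0] at hlt)
  have hb : 0 < ‖β 0‖ := norm_pos_iff.mpr hβ0
  set κ := α * β * α⁻¹ * β⁻¹ with hκ
  have hκε : ‖linearPart κ - 1‖ ≤ ‖linearPart β - 1‖ := by
    refine (norm_linearPart_commutator_sub_one_le α β).trans ?_
    refine mul_le_of_le_one_left (norm_nonneg _) ?_
    linarith
  set r := (linearPart κ - 1) (β 0) + (linearPart (α * β * α⁻¹) - 1) (α 0)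
  have hr : ‖r‖ ≤ 2 * ε * ‖β 0‖ := by
    have h1 : ‖r‖ ≤ ‖linearPart β - 1‖ * (‖β 0‖ + ‖α 0‖) := by
      rw [mul_add]
      refine (norm_add_le _ _).trans (add_le_add ?_ ?_)
      · exact ContinuousLinearMap.le_of_opNorm_le _ hκε _
      · exact ContinuousLinearMap.le_of_opNorm_le _ (norm_linearPart_conj_sub_one_le α β) _
    refine h1.trans ?_
    by_cases hβ1 : linearPart β = 1
    · rw [hβ1, sub_self, norm_zero, zero_mul]; positivity
    · have := hαmin β ⟨hβ, by linarith, hβ1⟩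
      nlinarith [norm_nonneg (linearPart β - 1)]
  have hκ0 : κ 0 = S (β 0) - r := commutator_apply_zero α β
  have hκlow : ‖S (β 0)‖ - ‖r‖ ≤ ‖κ 0‖ := hκ0 ▸ norm_sub_norm_le _ _
  have hκup : ‖κ 0‖ ≤ ‖S (β 0)‖ + ‖r‖ := hκ0 ▸ norm_sub_le _ _
  have hSβ : ‖S (β 0)‖ ≤ 1 / 2 * ‖β 0‖ := S.le_of_opNorm_le hα2 _
  have hκmem : κ ∈ Γ :=
    Γ.mul_mem (Γ.mul_mem (Γ.mul_mem hα hβ) (Γ.inv_mem hα)) (Γ.inv_mem hβ)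
  have hmin := hβmin κ ⟨hκmem, ?_, hκε.trans hβε, ?_⟩
  · nlinarith
  · rw [← norm_pos_iff]
    nlinarith
  · have h1 : ‖S (S (β 0))‖ - ‖S r‖ ≤ ‖S (κ 0)‖ := by
      rw [hκ0, map_sub]; exact norm_sub_norm_le _ _
    have h2 := S.le_opNorm r
    have h3 := hgain _ hβc
    have h4 : (‖S‖ + c) * ‖r‖ ≤ η * ‖β 0‖ :=
      calc (‖S‖ + c) * ‖r‖ ≤ (‖S‖ + c) * (2 * ε * ‖β 0‖) := by gcongr
        _ = (‖S‖ + c) * (2 * ε) * ‖β 0‖ := by ring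
        _ ≤ η * ‖β 0‖ := by gcongr
    have h5 : c * ‖κ 0‖ ≤ c * (‖S (β 0)‖ + ‖r‖) := by gcongr
    linarith

theorem finite_image_linearPart (hfin : ∀ R : ℝ, {g | g ∈ Γ ∧ ‖g 0‖ ≤ R}.Finite)
    (hco : ∃ d : ℝ, ∀ x, ∃ g ∈ Γ, ‖g 0 - x‖ ≤ d) : (linearPart '' (Γ : Set (E ≃ᵢ E))).Finite := by
  refine Set.Finite.of_isBounded_image_of_separated (f := id) (ε := 1 / 2) ?_ (by norm_num) ?_
  · refine (Metric.isBounded_closedBall (x := (0 : E →L[ℝ] E)) (r := 1)).subset ?_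
    rintro _ ⟨_, ⟨g, -, rfl⟩, rfl⟩
    simpa using norm_linearPart_le g
  · rintro _ ⟨g, hg, rfl⟩ _ ⟨h, hh, rfl⟩ hlt
    rw [id, id, dist_eq_norm] at hlt
    have := linearPart_eq_one_of_norm_le hfin hco (Γ.mul_mem hg (Γ.inv_mem hh))
      ((norm_linearPart_mul_inv_sub_one_le g h).trans hlt.le)
    rw [← inv_mul_cancel_right g h, map_mul, this, one_mul]

theorem span_translations_eq_top (hfin : ∀ R : ℝ, {g | g ∈ Γ ∧ ‖g 0‖ ≤ R}.Finite)
    (hco : ∃ d : ℝ, ∀ x, ∃ g ∈ Γ, ‖g 0 - x‖ ≤ d) :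
    Submodule.span ℝ {t : E | IsometryEquiv.addRight t ∈ Γ} = ⊤ := by
  rw [← Submodule.orthogonal_eq_bot_iff, Submodule.eq_bot_iff]
  intro u hu
  by_contra hu0
  have hpos : 0 < ‖u‖ := norm_pos_iff.mpr hu0
  obtain ⟨g, hg, k, hk, hgε, hgu⟩ := exists_near_direction hco u (ε := 1 / 2) (by norm_num) hpos
  have h1 := linearPart_eq_one_of_norm_le hfin hco hg hgε
  have hgt : IsometryEquiv.addRight (g 0) ∈ Γ := (addRight_apply_zero_eq_self h1).symm ▸ hg
  have h0 : inner ℝ (g 0) u = 0 :=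
    (Submodule.mem_orthogonal _ _).mp hu _ (Submodule.subset_span hgt)
  have h2 : ‖g 0 - k • u‖ ^ 2 = ‖g 0‖ ^ 2 + (‖u‖ * k) ^ 2 := by
    rw [norm_sub_sq_real, inner_smul_right, h0, norm_smul, Real.norm_eq_abs, abs_of_pos hk]
    ring
  have h3 := pow_lt_pow_left₀ hgu (norm_nonneg _) two_ne_zero
  nlinarith [sq_nonneg ‖g 0‖]

theorem nonempty_translationLattice_equiv (hfin : ∀ R : ℝ, {g | g ∈ Γ ∧ ‖g 0‖ ≤ R}.Finite)
    (hco : ∃ d : ℝ, ∀ x, ∃ g ∈ Γ, ‖g 0 - x‖ ≤ d) :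
    Nonempty (translationLattice Γ ≃+ (Fin (Module.finrank ℝ E) → ℤ)) := by
  let L : Submodule ℤ E := (translationLattice Γ).toIntSubmodule
  have hdisc : DiscreteTopology L := by
    by_cases hne : {g | g ∈ Γ ∧ g 0 ≠ 0}.Nonempty
    · obtain ⟨g, ⟨-, hg0⟩, hmin⟩ := exists_min_norm hfin (fun _ h => h.1) hne
      refine DiscreteTopology.of_forall_le_norm (norm_pos_iff.mpr hg0) fun t ht => ?_
      have h0 : IsometryEquiv.addRight (t : E) 0 = t := zero_add _
      have := hmin _ ⟨mem_translationLattice.mp t.2, by rw [h0]; exact_mod_cast ht⟩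
      rwa [h0] at this
    · refine DiscreteTopology.of_forall_le_norm one_pos fun t ht => ?_
      have h0 : IsometryEquiv.addRight (t : E) 0 = t := zero_add _
      exact absurd ⟨_, mem_translationLattice.mp t.2, by rw [h0]; exact_mod_cast ht⟩ hne
  have hlat : IsZLattice ℝ L := ⟨span_translations_eq_top hfin hco⟩
  have := ZLattice.module_free ℝ L
  have := ZLattice.module_finite ℝ L
  have hrank := ZLattice.rank ℝ L
  exact ⟨(Module.finBasisOfFinrankEq ℤ L hrank).equivFun.toAddEquiv⟩

end Bieberbach

section Euclidean

variable {n : ℕ} {Γ : Subgroup (EuclideanSpace ℝ (Fin n) ≃ᵢ EuclideanSpace ℝ (Fin n))}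

theorem IsCrystallographic.exists_separation (hΓ : IsCrystallographic Γ) :
    ∃ ε > 0, ∀ g ∈ Γ, ‖linearPart g - 1‖ < ε → ‖g 0‖ < ε → g = 1 := by
  have := hΓ.1
  obtain ⟨U, hU, hU1⟩ := isOpen_induced_iff.mp (isOpen_discrete ({1} : Set Γ))
  obtain ⟨V, hV, rfl⟩ := isOpen_induced_iff.mp hU
  let Φ : (EuclideanSpace ℝ (Fin n) →L[ℝ] EuclideanSpace ℝ (Fin n)) × EuclideanSpace ℝ (Fin n) →
    EuclideanSpace ℝ (Fin n) → EuclideanSpace ℝ (Fin n) := fun p x => p.1 x + p.2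
  have hΦ : Continuous Φ := by fun_prop
  have hmem (g : EuclideanSpace ℝ (Fin n) ≃ᵢ EuclideanSpace ℝ (Fin n)) :
      Φ (linearPart g, g 0) = g := by
    ext1 x
    exact (apply_eq_linearPart_add g x).symm
  have h1 : ((1 : Γ) : EuclideanSpace ℝ (Fin n) ≃ᵢ EuclideanSpace ℝ (Fin n)) ∈
      (fun f : EuclideanSpace ℝ (Fin n) ≃ᵢ EuclideanSpace ℝ (Fin n) =>
        (f : EuclideanSpace ℝ (Fin n) → EuclideanSpace ℝ (Fin n))) ⁻¹' V := by
    have : (1 : Γ) ∈ ({1} : Set Γ) := rfl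
    rwa [← hU1] at this
  obtain ⟨ε, hε, hball⟩ := Metric.isOpen_iff.mp (hV.preimage hΦ) (1, 0) (by
    have := hmem 1
    rw [map_one] at this
    rw [Set.mem_preimage]
    exact this ▸ h1)
  refine ⟨ε, hε, fun g hg hgA hga => ?_⟩
  have hgV : Φ (linearPart g, g 0) ∈ V := hball (by
    rw [Metric.mem_ball, Prod.dist_eq, max_lt_iff, dist_eq_norm, dist_zero_right]
    exact ⟨hgA, hga⟩)
  rw [hmem] at hgV
  have : (⟨g, hg⟩ : Γ) ∈ ({1} : Set Γ) := hU1 ▸ hgV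
  exact congrArg Subtype.val this

theorem IsCrystallographic.finite_norm_le (hΓ : IsCrystallographic Γ) (R : ℝ) :
    {g | g ∈ Γ ∧ ‖g 0‖ ≤ R}.Finite := by
  obtain ⟨ε, hε, hsep⟩ := hΓ.exists_separation
  refine Set.Finite.of_isBounded_image_of_separated (f := fun g => (linearPart g, g 0)) ?_ hε ?_
  · refine ((Metric.isBounded_closedBall (x := 0) (r := 1)).prod
      (Metric.isBounded_closedBall (x := 0) (r := R))).subset ?_
    rintro _ ⟨g, hg, rfl⟩
    exact ⟨by simpa using norm_linearPart_le g, by simpa using hg.2⟩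
  · rintro g ⟨hg, -⟩ h ⟨hh, -⟩ hlt
    rw [dist_comm, Prod.dist_eq, max_lt_iff, dist_eq_norm, dist_eq_norm] at hlt
    refine inv_mul_eq_one.mp (hsep _ (Γ.mul_mem (Γ.inv_mem hg) hh) ?_ ?_)
    · exact (norm_linearPart_inv_mul_sub_one_le g h).trans_lt hlt.1
    · rw [inv_mul_apply_zero, norm_linearPart_apply]
      exact hlt.2

theorem IsCrystallographic.exists_orbit_near (hΓ : IsCrystallographic Γ) :
    ∃ d : ℝ, ∀ x, ∃ g ∈ Γ, ‖g 0 - x‖ ≤ d := by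
  have := hΓ.2
  have : ContinuousConstSMul Γ (EuclideanSpace ℝ (Fin n)) :=
    ⟨fun g => (g : EuclideanSpace ℝ (Fin n) ≃ᵢ EuclideanSpace ℝ (Fin n)).continuous⟩
  let q : EuclideanSpace ℝ (Fin n) → MulAction.orbitRel.Quotient Γ (EuclideanSpace ℝ (Fin n)) :=
    Quotient.mk _
  have hq : IsOpenMap q := isOpenMap_quotient_mk'_mul
  obtain ⟨t, ht⟩ := isCompact_univ.elim_directed_cover (fun k : ℕ => q '' Metric.ball 0 k)
    (fun k => hq _ Metric.isOpen_ball) (by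
      intro y _
      obtain ⟨x, rfl⟩ := Quotient.exists_rep y
      obtain ⟨k, hk⟩ := exists_nat_gt ‖x‖
      exact Set.mem_iUnion.mpr ⟨k, x, by simpa using hk, rfl⟩)
    (directed_of_isDirected_le fun i j hij =>
      Set.image_mono (Metric.ball_subset_ball (by exact_mod_cast hij)))
  refine ⟨t, fun x => ?_⟩
  obtain ⟨y, hy, hyx⟩ := ht (Set.mem_univ (q x))
  obtain ⟨g, hg⟩ := MulAction.orbitRel_apply.mp (Quotient.exact hyx)
  have hg' : (g : EuclideanSpace ℝ (Fin n) ≃ᵢ EuclideanSpace ℝ (Fin n)) x = y := hg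
  refine ⟨(g : EuclideanSpace ℝ (Fin n) ≃ᵢ EuclideanSpace ℝ (Fin n))⁻¹, Γ.inv_mem g.2, ?_⟩
  have hx : (g : EuclideanSpace ℝ (Fin n) ≃ᵢ EuclideanSpace ℝ (Fin n))⁻¹ y = x := by
    rw [← hg', ← IsometryEquiv.mul_apply, inv_mul_cancel]; rfl
  rw [← hx, ← dist_eq_norm, IsometryEquiv.dist_eq, dist_comm]
  exact (Metric.mem_ball.mp hy).le

theorem mem_translationSubgroup_iff
    {g : EuclideanSpace ℝ (Fin n) ≃ᵢ EuclideanSpace ℝ (Fin n)} :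
    g ∈ translationSubgroup n ↔ linearPart g = 1 := by
  constructor
  · rintro ⟨t, ht⟩
    ext1 x
    simp [linearPart_apply, ht]
  · intro h
    exact ⟨g 0, fun x => by rw [apply_eq_linearPart_add g x, h]; rfl⟩

/-- The translations in `Γ` correspond to the lattice of translation vectors. -/
noncomputable def translationsEquivLattice
    (Γ : Subgroup (EuclideanSpace ℝ (Fin n) ≃ᵢ EuclideanSpace ℝ (Fin n))) :
    ↥(translationSubgroup n ⊓ Γ) ≃* Multiplicative (translationLattice Γ) where
  toFun g := Multiplicative.ofAdd ⟨g.1 0, by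
    rw [mem_translationLattice,
      addRight_apply_zero_eq_self (mem_translationSubgroup_iff.mp g.2.1)]
    exact g.2.2⟩
  invFun t := ⟨IsometryEquiv.addRight (t.toAdd : EuclideanSpace ℝ (Fin n)),
    ⟨_, fun _ => rfl⟩, t.toAdd.2⟩
  left_inv g :=
    Subtype.ext (addRight_apply_zero_eq_self (mem_translationSubgroup_iff.mp g.2.1))
  right_inv t := by
    refine congrArg Multiplicative.ofAdd (Subtype.ext ?_)
    exact zero_add _
  map_mul' g h := by
    have h1 := mem_translationSubgroup_iff.mp g.2.1
    refine congrArg Multiplicative.ofAdd (Subtype.ext ?_)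
    change g.1 (h.1 0) = g.1 0 + h.1 0
    rw [apply_eq_linearPart_add g.1 (h.1 0), h1, add_comm]
    rfl

end Euclidean

/-- **Bieberbach's first theorem** (Theorem 2.2 in Long–Reid): an `n`-dimensional
crystallographic group `Γ` contains a normal subgroup of finite index consisting of
translations, which is free abelian of rank `n`. -/
theorem crystallographic_translations_normal_finiteIndex_free_abelian (n : ℕ) (hn : 1 ≤ n)
    (Γ : Subgroup (EuclideanSpace ℝ (Fin n) ≃ᵢ EuclideanSpace ℝ (Fin n)))
    (hΓ : IsCrystallographic Γ) :
    ((translationSubgroup n ⊓ Γ).subgroupOf Γ).Normal ∧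
      ((translationSubgroup n ⊓ Γ).subgroupOf Γ).FiniteIndex ∧
      Nonempty (↥(translationSubgroup n ⊓ Γ) ≃* Multiplicative (Fin n → ℤ)) := by
  have hfin := hΓ.finite_norm_le
  have hco := hΓ.exists_orbit_near
  have hker : (translationSubgroup n ⊓ Γ).subgroupOf Γ =
      (linearPart.toHomUnits.comp Γ.subtype).ker := by
    ext g
    rw [Subgroup.mem_subgroupOf, Subgroup.mem_inf, mem_translationSubgroup_iff, MonoidHom.mem_ker,
      Units.ext_iff]
    exact and_iff_left g.2
  rw [hker]
  refine ⟨inferInstance, ?_, ?_⟩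
  · have : Finite (linearPart.toHomUnits.comp Γ.subtype).range := by
      refine Set.Finite.of_finite_image (f := Units.val)
        ((finite_image_linearPart hfin hco).subset ?_) Units.val_injective.injOn
      rintro _ ⟨_, ⟨g, rfl⟩, rfl⟩
      exact ⟨g, g.2, rfl⟩
    infer_instance
  · obtain ⟨e⟩ := nonempty_translationLattice_equiv hfin hco
    rw [finrank_euclideanSpace_fin] at e
    exact ⟨(translationsEquivLattice Γ).trans e.toMultiplicative⟩
end

section
/- Let G be a group and let H ≤ K ≤ G be subgroups. Assume that H is separable in G and that H has finite index in K. Then K is separable in G: for every g ∈ G with g ∉ K there exists a finite-index subgroup L of G with K ≤ L and g ∉ L. -/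
/-- **Lemma 2.5** (Long–Reid). Let `H ≤ K ≤ G`. If `H` is separable in `G` and `H` has finite
index in `K`, then `K` is separable in `G`. -/
theorem separable_of_finiteIndex_supergroup {G : Type*} [Group G] (H K : Subgroup G)
    (hHK : H ≤ K)
    (hsep : ∀ g : G, g ∉ H → ∃ L : Subgroup G, L.FiniteIndex ∧ H ≤ L ∧ g ∉ L)
    (hfin : (H.subgroupOf K).FiniteIndex) :
    ∀ g : G, g ∉ K → ∃ L : Subgroup G, L.FiniteIndex ∧ K ≤ L ∧ g ∉ L := by
  intro g hg
  have hout : ∀ q : K ⧸ H.subgroupOf K, ((q.out : K) : G)⁻¹ * g ∉ H := fun q hq =>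
    hg ((K.mul_mem_cancel_left (K.inv_mem q.out.2)).1 (hHK hq))
  choose L hLfin hHL hgL using fun q => hsep _ (hout q)
  have : Finite (K ⧸ H.subgroupOf K) := Subgroup.finite_quotient_of_finiteIndex
  have : (⨅ q, L q).FiniteIndex := Subgroup.finiteIndex_iInf hLfin
  refine ⟨K ⊔ (⨅ q, L q).normalCore, Subgroup.finiteIndex_of_le le_sup_right, le_sup_left, ?_⟩
  intro hmem
  obtain ⟨k, hk, n, hn, rfl⟩ := Subgroup.mem_sup_of_normal_right.1 hmem
  let q : K ⧸ H.subgroupOf K := QuotientGroup.mk ⟨k, hk⟩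
  have hkH : ((q.out : K) : G)⁻¹ * k ∈ H := by
    have h : (q.out : K)⁻¹ * ⟨k, hk⟩ ∈ H.subgroupOf K :=
      QuotientGroup.eq.1 (QuotientGroup.out_eq' q)
    exact Subgroup.mem_subgroupOf.1 h
  have hnL : n ∈ L q := iInf_le L q (Subgroup.normalCore_le _ hn)
  exact hgL q (by simpa only [mul_assoc] using (L q).mul_mem (hHL q hkH) hnL)
end

section
/- Let G be a residually finite group and let A be a maximal abelian subgroup of G, i.e. A is abelian and is not properly contained in any abelian subgroup of G. Then A is separable in G: for every g ∈ G with g ∉ A there exists a finite-index subgroup K of G with A ≤ K and g ∉ K. -/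
/-- **Lemma 2.6** (Long–Reid). In a residually finite group `G`, every maximal abelian
subgroup `A` is separable in `G`. -/
theorem maximal_abelian_separable_of_residually_finite {G : Type*} [Group G]
    (hres : ∀ g : G, g ≠ 1 → ∃ (F : Type) (_ : Group F) (φ : G →* F), Finite F ∧ φ g ≠ 1)
    (A : Subgroup G)
    (hab : ∀ a ∈ A, ∀ b ∈ A, a * b = b * a)
    (hmax : ∀ B : Subgroup G, (∀ a ∈ B, ∀ b ∈ B, a * b = b * a) → A ≤ B → B = A) :
    ∀ g : G, g ∉ A → ∃ K : Subgroup G, K.FiniteIndex ∧ A ≤ K ∧ g ∉ K := by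
  intro g hg
  obtain ⟨a, ha, hne⟩ : ∃ a ∈ A, a * g ≠ g * a := by
    by_contra! hcomm
    let s : Set G := insert g (A : Set G)
    have hs : ∀ x ∈ s, ∀ y ∈ s, x * y = y * x := by
      rintro x (rfl | hx) y (rfl | hy)
      · rfl
      · exact (hcomm y hy).symm
      · exact hcomm x hx
      · exact hab x hx y hy
    have := Subgroup.isMulCommutative_closure hs
    have hB : ∀ x ∈ Subgroup.closure s, ∀ y ∈ Subgroup.closure s, x * y = y * x :=
      fun x hx y hy => setLike_mul_comm hx hy
    have hEq := hmax _ hB fun x hx => Subgroup.subset_closure (Set.mem_insert_of_mem g hx)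
    exact hg (hEq ▸ Subgroup.subset_closure (Set.mem_insert g _))
  obtain ⟨F, _, φ, hF, hφ⟩ := hres (a * g * (g * a)⁻¹) (mt mul_inv_eq_one.mp hne)
  refine ⟨(Subgroup.centralizer {φ a}).comap φ, ⟨?_⟩, fun x hx => ?_, fun hgK => hφ ?_⟩
  · rw [Subgroup.index_comap]
    exact Subgroup.index_ne_zero_of_finite
  · rw [Subgroup.mem_comap, Subgroup.mem_centralizer_singleton_iff, ← map_mul, ← map_mul,
      hab x hx a ha]
  · rw [Subgroup.mem_comap, Subgroup.mem_centralizer_singleton_iff] at hgK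
    rw [map_mul, map_inv, mul_inv_eq_one, map_mul, map_mul, hgK]
end
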